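/- arXiv:1812.04285 — 2 statements merged into one kernel-verified Lean document; each statement's English description precedes it below -/
import Mathlib

section
/- Let (X,Φ) be a regular topological flow and let S be a weakly extendable cross-section of time η > 0. Then the restriction of Φ to Int^Φ(S) × (−η,η) is a homeomorphism onto Int(S_η); in particular Int^Φ(Int^Φ(S)) = Int^Φ(S). Moreover, for every 0 ≤ ζ ≤ η the topological boundary in X of the cylinder S_ζ equals the union of ∂^Φ S_ζ, φ_{−ζ}(S̄) and φ_{ζ}(S̄). -/
open Set Filter Topology MeasureTheory

namespace FlowPaper

variable {X : Type*} [MetricSpace X]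

/-- The flow `Φ` is regular when no point is fixed by the whole flow. -/
def Regular (Φ : Flow ℝ X) : Prop := ∀ x : X, ∃ t : ℝ, Φ t x ≠ x

/-- `φ_I(E) = {φ_t x : t ∈ I, x ∈ E}`. -/
def flowSet (Φ : Flow ℝ X) (I : Set ℝ) (E : Set X) : Set X := ⋃ t ∈ I, Φ t '' E

/-- The `ζ`-cylinder `S_ζ = φ_{[-ζ,ζ]}(S)`. -/
def cyl (Φ : Flow ℝ X) (S : Set X) (ζ : ℝ) : Set X := flowSet Φ (Icc (-ζ) ζ) S

/-- `S` is a cross-section of time `η` if `Φ` is injective on `S × [-η,η]`. -/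
def IsCrossSection (Φ : Flow ℝ X) (S : Set X) (η : ℝ) : Prop :=
  Set.InjOn (fun p : X × ℝ => Φ p.2 p.1) (S ×ˢ Icc (-η) η)

/-- Weakly extendable cross-section of time `η`. -/
def IsWec (Φ : Flow ℝ X) (S : Set X) (η : ℝ) : Prop :=
  IsCrossSection Φ S η ∧ IsCrossSection Φ (closure S) η

/-- The flow interior `Int^Φ(S) = Int(S_η) ∩ S`. -/
def flowInterior (Φ : Flow ℝ X) (S : Set X) (η : ℝ) : Set X := interior (cyl Φ S η) ∩ S

/-- The flow boundary `∂^Φ S = closure S \ Int^Φ(S)`. -/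
def flowBoundary (Φ : Flow ℝ X) (S : Set X) (η : ℝ) : Set X := closure S \ flowInterior Φ S η

/-- `∂^Φ S_ζ = φ_{[-ζ,ζ]}(∂^Φ S)`. -/
def flowBoundaryCyl (Φ : Flow ℝ X) (S : Set X) (η ζ : ℝ) : Set X := cyl Φ (flowBoundary Φ S η) ζ

/-- A cross-section is global when some cylinder covers `X`. -/
def IsGlobal (Φ : Flow ℝ X) (S : Set X) : Prop := ∃ ξ > 0, cyl Φ S ξ = univ

/-- First return time `t_S(x) = inf {t > 0 : φ_t x ∈ S}`. -/
noncomputable def returnTime (Φ : Flow ℝ X) (S : Set X) (x : X) : ℝ :=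
  sInf {t : ℝ | 0 < t ∧ Φ t x ∈ S}

/-- First return map `T_S(x) = φ_{t_S(x)}(x)`. -/
noncomputable def returnMap (Φ : Flow ℝ X) (S : Set X) (x : X) : X := Φ (returnTime Φ S x) x

/-- A measure is `Φ`-invariant when it is invariant under every time `t`-map. -/
def FlowInvariant [MeasurableSpace X] (Φ : Flow ℝ X) (μ : Measure X) : Prop :=
  ∀ t : ℝ, Measure.map (Φ t) μ = μ

/-- A w.e.c. `S` of time `η` has small flow boundary when `∂^Φ S_η` is a null set. -/
def HasSmallFlowBoundary [MeasurableSpace X] (Φ : Flow ℝ X) (S : Set X) (η : ℝ) : Prop :=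
  ∀ μ : Measure X, IsProbabilityMeasure μ → FlowInvariant Φ μ → μ (flowBoundaryCyl Φ S η η) = 0

/-- The small flow boundary property of a flow. -/
def SmallFlowBoundaryProperty [MeasurableSpace X] (Φ : Flow ℝ X) : Prop :=
  ∀ x : X, ∀ S' : Set X, ∀ η : ℝ, 0 < η → IsWec Φ S' η → x ∈ flowInterior Φ S' η →
    ∃ S ⊆ S', x ∈ flowInterior Φ S η ∧ IsWec Φ S η ∧ HasSmallFlowBoundary Φ S η

/-- The frontier of `A` with respect to the topology induced on `B`. -/
def frontierIn (B A : Set X) : Set X :=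
  Subtype.val '' (frontier (Subtype.val ⁻¹' A : Set B))

theorem mem_cyl {Φ : Flow ℝ X} {S : Set X} {ζ : ℝ} {y : X} :
    y ∈ cyl Φ S ζ ↔ ∃ t ∈ Icc (-ζ) ζ, ∃ x ∈ S, Φ t x = y := by
  simp [cyl, flowSet]

theorem continuous_flow_prod (Φ : Flow ℝ X) : Continuous fun p : X × ℝ => Φ p.2 p.1 :=
  Φ.continuous continuous_snd continuous_fst

theorem cyl_eq_image (Φ : Flow ℝ X) (S : Set X) (ζ : ℝ) :
    cyl Φ S ζ = (fun p : X × ℝ => Φ p.2 p.1) '' (S ×ˢ Icc (-ζ) ζ) := by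
  ext y
  simp only [mem_cyl, mem_image, Prod.exists, mem_prod]
  exact ⟨fun ⟨t, ht, x, hx, h⟩ => ⟨x, t, ⟨hx, ht⟩, h⟩,
    fun ⟨x, t, ⟨hx, ht⟩, h⟩ => ⟨t, ht, x, hx, h⟩⟩

theorem closure_cyl [CompactSpace X] (Φ : Flow ℝ X) (S : Set X) (ζ : ℝ) :
    closure (cyl Φ S ζ) = cyl Φ (closure S) ζ := by
  have hf := continuous_flow_prod Φ
  rw [cyl_eq_image, cyl_eq_image]
  apply Subset.antisymm
  · refine closure_minimal (image_mono (prod_mono_left subset_closure)) ?_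
    exact ((isClosed_closure.isCompact.prod isCompact_Icc).image hf).isClosed
  · refine Subset.trans ?_ (image_closure_subset_closure_image hf)
    rw [closure_prod_eq, isClosed_Icc.closure_eq]

/-- The flow restricted to a compact cross-section times its time interval is an embedding. -/
theorem IsCrossSection.isEmbedding [CompactSpace X] {Φ : Flow ℝ X} {S : Set X} {η : ℝ}
    (hS : IsCrossSection Φ (closure S) η) :
    IsEmbedding ((closure S ×ˢ Icc (-η) η).domRestrict fun p : X × ℝ => Φ p.2 p.1) := by
  have : CompactSpace ↥(closure S ×ˢ Icc (-η) η) :=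
    isCompact_iff_compactSpace.mp (isClosed_closure.isCompact.prod isCompact_Icc)
  exact ((continuous_flow_prod Φ).comp continuous_subtype_val).isClosedEmbedding
    (injOn_iff_injective.mp hS) |>.isEmbedding

/-- The time coordinate on the cylinder of a compact cross-section is continuous. -/
theorem IsCrossSection.eventually_abs_sub_lt [CompactSpace X] {Φ : Flow ℝ X} {S : Set X} {η : ℝ}
    (hS : IsCrossSection Φ (closure S) η) {x : X} (hx : x ∈ closure S) {t : ℝ}
    (ht : t ∈ Icc (-η) η) {ε : ℝ} (hε : 0 < ε) :
    ∀ᶠ w in 𝓝 (Φ t x), ∀ x' ∈ closure S, ∀ s ∈ Icc (-η) η, Φ s x' = w → |s - t| < ε := by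
  have hnear : ∀ᶠ q : ↥(closure S ×ˢ Icc (-η) η) in 𝓝 ⟨(x, t), hx, ht⟩, |q.1.2 - t| < ε := by
    have hc : Continuous fun q : ↥(closure S ×ˢ Icc (-η) η) => |q.1.2 - t| := by fun_prop
    exact hc.continuousAt.eventually_lt continuousAt_const (by simpa using hε)
  rw [hS.isEmbedding.nhds_eq_comap, eventually_comap] at hnear
  filter_upwards [hnear] with w hw x' hx' s hs h
  exact hw ⟨(x', s), hx', hs⟩ h

theorem flow_neg_apply (Φ : Flow ℝ X) (t : ℝ) (x : X) : Φ (-t) (Φ t x) = x := by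
  rw [← Φ.map_add, neg_add_cancel, Φ.map_zero_apply]

/-- A point of a cross-section does not return to it within small nonzero time. -/
theorem IsCrossSection.eq_zero {Φ : Flow ℝ X} {S : Set X} {η : ℝ}
    (hS : IsCrossSection Φ S η) {x y : X} (hx : x ∈ S) (hy : y ∈ S) {t : ℝ}
    (ht : t ∈ Icc (-η) η) (h : Φ t x = y) : t = 0 := by
  have h0 : (0 : ℝ) ∈ Icc (-η) η := ⟨by linarith [ht.1, ht.2], by linarith [ht.1, ht.2]⟩
  have := @hS (x, t) ⟨hx, ht⟩ (y, 0) ⟨hy, h0⟩ (by simpa using h)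
  exact congrArg Prod.snd this

theorem eventually_flow_mem_of_mem_interior (Φ : Flow ℝ X) (A : Set X) {t : ℝ} {x : X}
    (h : Φ t x ∈ interior A) : ∀ᶠ r in 𝓝 t, Φ r x ∈ A := by
  have hc : Continuous fun r : ℝ => Φ r x := Φ.continuous continuous_id continuous_const
  exact hc.continuousAt.eventually (mem_interior_iff_mem_nhds.mp h)

/-- Interior points of a cylinder have time coordinate in the open interval. -/
theorem IsWec.mem_Ioo_of_mem_interior [CompactSpace X] {Φ : Flow ℝ X} {S : Set X} {η ζ : ℝ}
    (hS : IsWec Φ S η) (hη : 0 < η) (hζ : ζ ≤ η) {x : X} (hx : x ∈ S) {t : ℝ}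
    (ht : t ∈ Icc (-ζ) ζ) (h : Φ t x ∈ interior (cyl Φ S ζ)) : t ∈ Ioo (-ζ) ζ := by
  have htη : t ∈ Icc (-η) η := ⟨by linarith [ht.1], by linarith [ht.2]⟩
  have hnear := hS.2.eventually_abs_sub_lt (subset_closure hx) htη (half_pos hη)
  have hc : Continuous fun r : ℝ => Φ r x := Φ.continuous continuous_id continuous_const
  have hclose : ∀ᶠ r in 𝓝 t, |r - t| < η / 2 := by
    have hc : Continuous fun r : ℝ => |r - t| := by fun_prop
    exact hc.continuousAt.eventually_lt continuousAt_const (by simpa using half_pos hη)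
  -- times near `t` stay in `[-ζ, ζ]`, as the time coordinate of a point is determined by it
  have key : ∀ᶠ r in 𝓝 t, r ∈ Icc (-ζ) ζ := by
    filter_upwards [hc.continuousAt.eventually hnear, hclose,
      eventually_flow_mem_of_mem_interior Φ _ h] with r hr hrt hmem
    obtain ⟨s, hs, x', hx', hsx⟩ := mem_cyl.mp hmem
    have hst := hr x' (subset_closure hx') s ⟨by linarith [hs.1], by linarith [hs.2]⟩ hsx
    rw [abs_lt] at hst hrt
    have : r - s = 0 := by
      refine hS.1.eq_zero hx hx' ⟨by linarith, by linarith⟩ ?_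
      rw [sub_eq_neg_add, Φ.map_add, ← hsx, flow_neg_apply]
    rwa [sub_eq_zero.mp this]
  rw [← interior_Icc]
  exact mem_interior_iff_mem_nhds.mpr key

theorem IsWec.flow_mem_interior_cyl [CompactSpace X] {Φ : Flow ℝ X} {S : Set X} {η ζ ξ : ℝ}
    (hS : IsWec Φ S η) (hξ : ξ ≤ η) {x : X} (hx : x ∈ S) {t u : ℝ} (ht : t ∈ Icc (-η) η)
    (h : Φ t x ∈ interior (cyl Φ S ξ)) (hu : t + u ∈ Ioo (-ζ) ζ) :
    Φ (t + u) x ∈ interior (cyl Φ S ζ) := by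
  obtain ⟨ε, hε, hεζ⟩ : ∃ ε > 0, ∀ s, |s - t| < ε → s + u ∈ Icc (-ζ) ζ := by
    refine ⟨min (ζ - (t + u)) (t + u + ζ), lt_min (by linarith [hu.2]) (by linarith [hu.1]), ?_⟩
    intro s hs
    rw [lt_min_iff, abs_lt, abs_lt] at hs
    constructor <;> linarith [hs.1.1, hs.1.2, hs.2.1, hs.2.2]
  have hnear := (hS.2.eventually_abs_sub_lt (subset_closure hx) ht hε).and
    (mem_interior_iff_mem_nhds.mp h)
  have hback : Φ (-u) (Φ (t + u) x) = Φ t x := by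
    rw [← Φ.map_add]; congr 1; ring
  have hc : Continuous fun y : X => Φ (-u) y := Φ.continuous continuous_const continuous_id
  rw [mem_interior_iff_mem_nhds]
  rw [← hback] at hnear
  filter_upwards [hc.continuousAt.eventually hnear] with w ⟨hw, hmem⟩
  obtain ⟨s, hs, x', hx', hsx⟩ := mem_cyl.mp hmem
  have hst := hw x' (subset_closure hx') s ⟨by linarith [hs.1], by linarith [hs.2]⟩ hsx
  refine mem_cyl.mpr ⟨s + u, hεζ s hst, x', hx', ?_⟩
  rw [add_comm, Φ.map_add, hsx, ← Φ.map_add, add_neg_cancel, Φ.map_zero_apply]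

/-- The interior of a cylinder is the open cylinder over the flow interior. -/
theorem IsWec.interior_cyl [CompactSpace X] {Φ : Flow ℝ X} {S : Set X} {η ζ : ℝ}
    (hS : IsWec Φ S η) (hη : 0 < η) (hζ : ζ ≤ η) :
    interior (cyl Φ S ζ) =
      (fun p : X × ℝ => Φ p.2 p.1) '' (flowInterior Φ S η ×ˢ Ioo (-ζ) ζ) := by
  apply Subset.antisymm
  · intro y hy
    obtain ⟨t, ht, x, hx, rfl⟩ := mem_cyl.mp (interior_subset hy)
    refine ⟨(x, t), ⟨⟨?_, hx⟩, hS.mem_Ioo_of_mem_interior hη hζ hx ht hy⟩, rfl⟩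
    have := hS.flow_mem_interior_cyl (ζ := η) (u := -t) hζ hx
      ⟨by linarith [ht.1], by linarith [ht.2]⟩ hy (by simpa using hη)
    simpa using this
  · rintro _ ⟨⟨x, t⟩, ⟨⟨hx, hxS⟩, ht⟩, rfl⟩
    have := hS.flow_mem_interior_cyl (t := 0) (u := t) le_rfl hxS
      ⟨by linarith, hη.le⟩ (by simpa using hx) (by simpa using ht)
    simpa using this

/-- the flow map restricts to a homeomorphism from `Int^Φ(S) × (-η,η)` onto
`Int(S_η)`; in particular `Int^Φ(Int^Φ(S)) = Int^Φ(S)`, and the topological boundary of the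
cylinder `S_ζ` is `∂^Φ S_ζ ∪ φ_{-ζ}(closure S) ∪ φ_ζ(closure S)` for `0 ≤ ζ ≤ η`. -/
theorem flowInterior_homeo {X : Type*} [MetricSpace X] [CompactSpace X]
    (Φ : Flow ℝ X) (hreg : Regular Φ) (S : Set X) (η : ℝ) (hη : 0 < η)
    (hS : IsWec Φ S η) :
    (∃ e : ↥(flowInterior Φ S η ×ˢ Ioo (-η) η) ≃ₜ ↥(interior (cyl Φ S η)),
        ∀ p : ↥(flowInterior Φ S η ×ˢ Ioo (-η) η),
          (e p : X) = Φ (p : X × ℝ).2 (p : X × ℝ).1) ∧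
    flowInterior Φ (flowInterior Φ S η) η = flowInterior Φ S η ∧
    (∀ ζ : ℝ, 0 ≤ ζ → ζ ≤ η →
      frontier (cyl Φ S ζ) =
        flowBoundaryCyl Φ S η ζ ∪ Φ (-ζ) '' closure S ∪ Φ ζ '' closure S) := by
  have hsub : flowInterior Φ S η ×ˢ Ioo (-η) η ⊆ closure S ×ˢ Icc (-η) η :=
    prod_mono (inter_subset_right.trans subset_closure) Ioo_subset_Icc_self
  refine ⟨?_, ?_, ?_⟩
  · have hemb : IsEmbedding
        ((flowInterior Φ S η ×ˢ Ioo (-η) η).domRestrict fun p : X × ℝ => Φ p.2 p.1) :=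
      hS.2.isEmbedding.comp (IsEmbedding.inclusion hsub)
    have hrange : range ((flowInterior Φ S η ×ˢ Ioo (-η) η).domRestrict
        fun p : X × ℝ => Φ p.2 p.1) = interior (cyl Φ S η) := by
      rw [range_domRestrict, hS.interior_cyl hη le_rfl]
    exact ⟨hemb.toHomeomorph.trans (Homeomorph.setCongr hrange), fun p => rfl⟩
  · refine Subset.antisymm inter_subset_right fun x hx => ⟨?_, hx⟩
    refine interior_maximal ?_ isOpen_interior hx.1
    rw [hS.interior_cyl hη le_rfl, cyl_eq_image]
    exact image_mono (prod_mono_right Ioo_subset_Icc_self)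
  · intro ζ hζ0 hζ
    have hIcc : Icc (-ζ) ζ ⊆ Icc (-η) η := Icc_subset_Icc (neg_le_neg hζ) hζ
    rw [frontier, closure_cyl, hS.interior_cyl hη hζ]
    ext y
    constructor
    · rintro ⟨hy, hyn⟩
      obtain ⟨t, ht, x, hx, rfl⟩ := mem_cyl.mp hy
      rcases eq_or_lt_of_le ht.1 with h | h1
      · exact Or.inl (Or.inr ⟨x, hx, by rw [h]⟩)
      rcases eq_or_lt_of_le ht.2 with h | h2
      · exact Or.inr ⟨x, hx, by rw [h]⟩
      exact Or.inl (Or.inl (mem_cyl.mpr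
        ⟨t, ht, x, ⟨hx, fun hxi => hyn ⟨(x, t), ⟨hxi, h1, h2⟩, rfl⟩⟩, rfl⟩))
    · have aux : ∀ t ∈ Icc (-ζ) ζ, ∀ x ∈ closure S,
          (x ∈ flowInterior Φ S η → t ∉ Ioo (-ζ) ζ) →
          Φ t x ∈ cyl Φ (closure S) ζ \
            (fun p : X × ℝ => Φ p.2 p.1) '' (flowInterior Φ S η ×ˢ Ioo (-ζ) ζ) := by
        refine fun t ht x hx hn => ⟨mem_cyl.mpr ⟨t, ht, x, hx, rfl⟩, ?_⟩
        rintro ⟨⟨x', s⟩, ⟨hx', hs⟩, h⟩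
        have heq := @hS.2 (x', s) ⟨subset_closure hx'.2, hIcc (Ioo_subset_Icc_self hs)⟩
          (x, t) ⟨hx, hIcc ht⟩ h
        obtain ⟨rfl, rfl⟩ := Prod.mk.inj heq
        exact hn hx' hs
      rintro ((hy | ⟨x, hx, rfl⟩) | ⟨x, hx, rfl⟩)
      · obtain ⟨t, ht, x, hx, rfl⟩ := mem_cyl.mp hy
        exact aux t ht x hx.1 fun h => absurd h hx.2
      · exact aux _ ⟨le_rfl, by linarith⟩ x hx fun _ h => lt_irrefl _ h.1
      · exact aux _ ⟨by linarith, le_rfl⟩ x hx fun _ h => lt_irrefl _ h.2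

end FlowPaper
end

section
/- Let (X,Φ) be a regular topological flow and let A and B be weakly extendable cross-sections of time η > 0 such that A ∪ B is also a weakly extendable cross-section of time η. Then ∂^Φ(A ∪ B) ⊆ ∂^Φ A ∪ ∂^Φ B. If moreover A and B are disjoint closed cross-sections of time η, then ∂^Φ(A ∪ B) = ∂^Φ A ∪ ∂^Φ B. -/
open Set Filter Topology MeasureTheory

namespace FlowPaper

variable {X : Type*} [MetricSpace X]

theorem cyl_mono (Φ : Flow ℝ X) {S T : Set X} (h : S ⊆ T) (ζ : ℝ) : cyl Φ S ζ ⊆ cyl Φ T ζ :=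
  iUnion₂_mono fun _ _ => image_mono h

theorem cyl_union (Φ : Flow ℝ X) (S T : Set X) (ζ : ℝ) :
    cyl Φ (S ∪ T) ζ = cyl Φ S ζ ∪ cyl Φ T ζ := by
  simp only [cyl, flowSet, image_union, iUnion_union_distrib]

theorem flowInterior_mono (Φ : Flow ℝ X) {S T : Set X} (h : S ⊆ T) (η : ℝ) :
    flowInterior Φ S η ⊆ flowInterior Φ T η :=
  inter_subset_inter (interior_mono (cyl_mono Φ h η)) h

theorem isCompact_cyl (Φ : Flow ℝ X) {S : Set X} (hS : IsCompact S) (ζ : ℝ) :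
    IsCompact (cyl Φ S ζ) := by
  have h : cyl Φ S ζ = (fun p : ℝ × X => Φ p.1 p.2) '' (Icc (-ζ) ζ ×ˢ S) := by
    ext x
    simp [cyl, flowSet, and_assoc]
  rw [h]
  exact (isCompact_Icc.prod hS).image (Φ.continuous continuous_fst continuous_snd)

/-- A cylinder over one part of a cross-section misses every disjoint part. -/
theorem IsCrossSection.disjoint_cyl {Φ : Flow ℝ X} {A B : Set X} {η : ℝ}
    (h : IsCrossSection Φ (A ∪ B) η) (hη : 0 ≤ η) (hd : Disjoint A B) :
    Disjoint A (cyl Φ B η) := by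
  rw [Set.disjoint_left]
  intro x hx hxB
  simp only [cyl, flowSet, mem_iUnion, mem_image] at hxB
  obtain ⟨t, ht, b, hb, rfl⟩ := hxB
  have heq := h (show (Φ t b, (0 : ℝ)) ∈ (A ∪ B) ×ˢ Icc (-η) η from
      ⟨Or.inl hx, by simpa using hη⟩)
    (show (b, t) ∈ (A ∪ B) ×ˢ Icc (-η) η from ⟨Or.inr hb, ht⟩) (Φ.map_zero_apply _)
  have hbx : Φ t b = b := congrArg Prod.fst heq
  exact Set.disjoint_left.1 hd hx (hbx.symm ▸ hb)

theorem flowBoundary_subset_flowBoundary_union [CompactSpace X] {Φ : Flow ℝ X} {A B : Set X}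
    {η : ℝ} (h : IsCrossSection Φ (A ∪ B) η) (hη : 0 ≤ η) (hd : Disjoint A B)
    (hA : IsClosed A) (hB : IsClosed B) :
    flowBoundary Φ A η ⊆ flowBoundary Φ (A ∪ B) η := by
  rintro x ⟨hxA, hx⟩
  refine ⟨closure_mono subset_union_left hxA, fun hxAB => hx ?_⟩
  rw [hA.closure_eq] at hxA
  refine ⟨?_, hxA⟩
  have hsub : interior (cyl Φ (A ∪ B) η) ∩ (cyl Φ B η)ᶜ ⊆ cyl Φ A η := by
    rintro y ⟨hy, hyB⟩
    have hy' := interior_subset hy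
    rw [cyl_union] at hy'
    exact hy'.resolve_right hyB
  exact interior_maximal hsub
    (isOpen_interior.inter (isCompact_cyl Φ hB.isCompact η).isClosed.isOpen_compl)
    ⟨hxAB.1, Set.disjoint_left.1 (h.disjoint_cyl hη hd) hxA⟩

/-- the flow boundary of a union of w.e.c.'s is contained in the union of the flow
boundaries, with equality when the cross-sections are disjoint and closed. -/
theorem flowBoundary_union {X : Type*} [MetricSpace X] [CompactSpace X]
    (Φ : Flow ℝ X) (hreg : Regular Φ) (A B : Set X) (η : ℝ) (hη : 0 < η)
    (hA : IsWec Φ A η) (hB : IsWec Φ B η) (hAB : IsWec Φ (A ∪ B) η) :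
    flowBoundary Φ (A ∪ B) η ⊆ flowBoundary Φ A η ∪ flowBoundary Φ B η ∧
    (Disjoint A B → IsClosed A → IsClosed B →
      flowBoundary Φ (A ∪ B) η = flowBoundary Φ A η ∪ flowBoundary Φ B η) := by
  have hsub : flowBoundary Φ (A ∪ B) η ⊆ flowBoundary Φ A η ∪ flowBoundary Φ B η := by
    rintro x ⟨hx, hxI⟩
    rw [closure_union] at hx
    exact hx.imp (fun h => ⟨h, fun hI => hxI (flowInterior_mono Φ subset_union_left η hI)⟩)
      (fun h => ⟨h, fun hI => hxI (flowInterior_mono Φ subset_union_right η hI)⟩)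
  refine ⟨hsub, fun hd hAc hBc => hsub.antisymm (union_subset ?_ ?_)⟩
  · exact flowBoundary_subset_flowBoundary_union hAB.1 hη.le hd hAc hBc
  · have h := hAB.1
    rw [union_comm] at h ⊢
    exact flowBoundary_subset_flowBoundary_union h hη.le hd.symm hBc hAc

end FlowPaper
end
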